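/- arXiv:1404.5580 — 2 statements merged into one kernel-verified Lean document; each statement's English description precedes it below -/
import Mathlib

section
/- For every k > 0, the improper integral lim_{T→∞} ∫_0^T t^{−1/2} e^{ikt} dt exists and equals √(π/k)·(√2/2)·(1+i); equivalently, the Fourier transform of φ at k equals (1/√(2π))·√π/(α√k). -/
open MeasureTheory Filter Real

/-- `α = √2/2 − i·√2/2`, so `α² = −i`. -/
noncomputable def α : ℂ := (Real.sqrt 2 / 2 : ℝ) - Complex.I * (Real.sqrt 2 / 2 : ℝ)

/-- `φ(t) = t^{−1/2}` for `t > 0` and `φ(t) = 0` for `t ≤ 0`. -/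
noncomputable def φ (t : ℝ) : ℝ := if 0 < t then 1 / Real.sqrt t else 0

theorem sq_sub_I_mul_ne_zero {k : ℝ} (hk : k ≠ 0) (x : ℝ) :
    (x : ℂ) ^ 2 - Complex.I * k ≠ 0 := by
  intro h
  have h' := congrArg Complex.im h
  simp [pow_two] at h'
  exact hk h'

theorem integrable_inv_sq_sub_I_mul {k : ℝ} (hk : 0 < k) :
    Integrable (fun x : ℝ => ((x : ℂ) ^ 2 - Complex.I * k)⁻¹) := by
  have hc : Continuous (fun x : ℝ => ((x : ℂ) ^ 2 - Complex.I * k)⁻¹) :=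
    Continuous.inv₀ (by fun_prop) (sq_sub_I_mul_ne_zero hk.ne')
  refine (integrable_inv_one_add_sq.const_mul (1 + 1 / k)).mono' hc.aestronglyMeasurable
    (ae_of_all _ fun x => ?_)
  have hre := Complex.abs_re_le_norm ((x : ℂ) ^ 2 - Complex.I * k)
  have him := Complex.abs_im_le_norm ((x : ℂ) ^ 2 - Complex.I * k)
  have hre' : ((x : ℂ) ^ 2 - Complex.I * k).re = x ^ 2 := by simp [pow_two]
  have him' : ((x : ℂ) ^ 2 - Complex.I * k).im = -k := by simp [pow_two]
  rw [hre', abs_of_nonneg (sq_nonneg x)] at hre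
  rw [him', abs_neg, abs_of_pos hk] at him
  have hpos : 0 < ‖(x : ℂ) ^ 2 - Complex.I * k‖ := hk.trans_le him
  have h1 : 1 ≤ 1 / k * ‖(x : ℂ) ^ 2 - Complex.I * k‖ := by
    rw [one_div, inv_mul_eq_div, one_le_div hk]; exact him
  rw [norm_inv, ← div_eq_mul_inv, inv_eq_one_div, div_le_div_iff₀ hpos (by positivity)]
  nlinarith

theorem tendsto_log_ofReal_add_sub_log (w : ℂ) :
    Tendsto (fun x : ℝ => Complex.log (x + w) - Real.log x) atTop (nhds 0) := by
  have hlim : Tendsto (fun x : ℝ => 1 + w * ((x⁻¹ : ℝ) : ℂ)) atTop (nhds 1) := by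
    have h := (Complex.continuous_ofReal.tendsto 0).comp tendsto_inv_atTop_zero
    simpa using (h.const_mul w).const_add 1
  have hlog := hlim.clog (by simp)
  rw [Complex.log_one] at hlog
  refine hlog.congr' ?_
  filter_upwards [eventually_gt_atTop (0 : ℝ), hlim.eventually_ne one_ne_zero] with x hx hne
  have hx' : (x : ℂ) ≠ 0 := by exact_mod_cast hx.ne'
  have heq : (x : ℂ) + w = x * (1 + w * ((x⁻¹ : ℝ) : ℂ)) := by
    push_cast; field_simp
  rw [heq, Complex.log_ofReal_mul hx hne, add_sub_cancel_left]

theorem integral_Ioi_inv_sq_sub_I_mul {k : ℝ} (hk : 0 < k) {w : ℂ} (hw : w ^ 2 = Complex.I * k)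
    (him : 0 < w.im) :
    ∫ x in Set.Ioi (0 : ℝ), ((x : ℂ) ^ 2 - Complex.I * k)⁻¹ = π * Complex.I / (2 * w) := by
  have hw0 : w ≠ 0 := by rintro rfl; simp at him
  have hderiv : ∀ x ∈ Set.Ici (0 : ℝ), HasDerivAt
      (fun x : ℝ => (Complex.log (x + -w) - Complex.log (x + w)) / (2 * w))
      (((x : ℂ) ^ 2 - Complex.I * k)⁻¹) x := by
    intro x _
    have hslit : ∀ v : ℂ, v.im ≠ 0 → (x : ℂ) + v ∈ Complex.slitPlane := fun v hv =>
      Complex.mem_slitPlane_iff.2 (Or.inr (by simpa using hv))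
    have hd : ∀ v : ℂ, HasDerivAt (fun x : ℝ => (x : ℂ) + v) 1 x := fun v =>
      (Complex.ofRealCLM.hasDerivAt (x := x)).add_const v
    have hm := hslit (-w) (by simpa using him.ne')
    have hp := hslit w him.ne'
    have h := (((hd (-w)).clog_real hm).sub ((hd w).clog_real hp)).div_const (2 * w)
    refine h.congr_deriv ?_
    have h1 := Complex.slitPlane_ne_zero hm
    have h2 := Complex.slitPlane_ne_zero hp
    have h3 : (x : ℂ) ^ 2 - Complex.I * k = (x + -w) * (x + w) := by rw [← hw]; ring
    rw [h3]
    field_simp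
    ring
  have hlim : Tendsto (fun x : ℝ => (Complex.log (x + -w) - Complex.log (x + w)) / (2 * w))
      atTop (nhds 0) := by
    simpa using ((tendsto_log_ofReal_add_sub_log (-w)).sub
      (tendsto_log_ofReal_add_sub_log w)).div_const (2 * w)
  rw [integral_Ioi_of_hasDerivAt_of_tendsto' hderiv
    (integrable_inv_sq_sub_I_mul hk).integrableOn hlim]
  have harg : Complex.log (-w) - Complex.log w = -(π * Complex.I) := by
    rw [Complex.log, Complex.log, norm_neg, Complex.arg_neg_eq_arg_sub_pi_of_im_pos him]
    push_cast; ring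
  simp only [Complex.ofReal_zero, zero_add, harg]
  ring

theorem norm_exp_I_mul_sub_sq_mul (k x t : ℝ) :
    ‖Complex.exp ((Complex.I * k - (x : ℂ) ^ 2) * t)‖ = Real.exp (-t * x ^ 2) := by
  rw [Complex.norm_exp]
  congr 1
  simp [pow_two]
  ring

theorem ofReal_φ_mul_exp_eq_integral (k : ℝ) {t : ℝ} (ht : 0 < t) :
    (φ t : ℂ) * Complex.exp (Complex.I * k * t) = ((2 / √π : ℝ) : ℂ) *
      ∫ x in Set.Ioi (0 : ℝ), Complex.exp ((Complex.I * k - (x : ℂ) ^ 2) * t) := by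
  have h : ∀ x : ℝ, Complex.exp ((Complex.I * k - (x : ℂ) ^ 2) * t) =
      Complex.exp (Complex.I * k * t) * ((Real.exp (-t * x ^ 2) : ℝ) : ℂ) := by
    intro x
    rw [Complex.ofReal_exp, ← Complex.exp_add]
    congr 1
    push_cast; ring
  simp_rw [h]
  rw [integral_const_mul, integral_complex_ofReal, integral_gaussian_Ioi, φ, if_pos ht,
    mul_left_comm, mul_comm]
  congr 1
  rw [← Complex.ofReal_mul]
  congr 1
  rw [Real.sqrt_div Real.pi_pos.le]
  have := (Real.sqrt_pos.2 Real.pi_pos).ne'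
  have := (Real.sqrt_pos.2 ht).ne'
  field_simp

theorem integrable_exp_I_mul_sub_sq_mul_prod (k T : ℝ) :
    Integrable (fun p : ℝ × ℝ => Complex.exp ((Complex.I * k - (p.2 : ℂ) ^ 2) * p.1))
      ((volume.restrict (Set.Ioc 0 T)).prod (volume.restrict (Set.Ioi 0))) := by
  have hc : Continuous
      (fun p : ℝ × ℝ => Complex.exp ((Complex.I * k - (p.2 : ℂ) ^ 2) * p.1)) := by fun_prop
  rw [integrable_prod_iff hc.aestronglyMeasurable]
  constructor
  · filter_upwards [ae_restrict_mem measurableSet_Ioc] with t ht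
    refine Integrable.mono' (integrable_exp_neg_mul_sq ht.1).integrableOn
      (by fun_prop) (ae_of_all _ fun x => ?_)
    exact (norm_exp_I_mul_sub_sq_mul k x t).le
  · simp_rw [norm_exp_I_mul_sub_sq_mul, integral_gaussian_Ioi]
    have hint : IntegrableOn (fun t : ℝ => √π / 2 * t ^ (-(1 / 2) : ℝ)) (Set.Ioc 0 T) := by
      rcases le_total 0 T with hT | hT
      · rw [← intervalIntegrable_iff_integrableOn_Ioc_of_le hT]
        exact (intervalIntegral.intervalIntegrable_rpow' (by norm_num)).const_mul _
      · simp [Set.Ioc_eq_empty_of_le hT]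
    refine hint.congr_fun (fun t ht => ?_) measurableSet_Ioc
    simp only
    rw [Real.sqrt_div Real.pi_pos.le, Real.rpow_neg ht.1.le, ← Real.sqrt_eq_rpow]
    ring

theorem integral_Ioc_exp_I_mul_sub_sq_mul {k : ℝ} (hk : k ≠ 0) (x : ℝ) {T : ℝ} (hT : 0 ≤ T) :
    ∫ t in Set.Ioc 0 T, Complex.exp ((Complex.I * k - (x : ℂ) ^ 2) * t) =
      (1 - Complex.exp ((Complex.I * k - (x : ℂ) ^ 2) * T)) *
        ((x : ℂ) ^ 2 - Complex.I * k)⁻¹ := by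
  have h0 := sq_sub_I_mul_ne_zero hk x
  have h1 : Complex.I * k - (x : ℂ) ^ 2 ≠ 0 := by
    rw [← neg_sub]; exact neg_ne_zero.2 h0
  rw [← intervalIntegral.integral_of_le hT, integral_exp_mul_complex h1,
    ← neg_sub ((x : ℂ) ^ 2) (Complex.I * k)]
  simp only [Complex.ofReal_zero, mul_zero, Complex.exp_zero]
  field_simp
  ring

theorem integral_Ioc_φ_mul_exp {k : ℝ} (hk : k ≠ 0) {T : ℝ} (hT : 0 ≤ T) :
    ∫ t in Set.Ioc (0 : ℝ) T, (φ t : ℂ) * Complex.exp (Complex.I * k * t) =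
      ((2 / √π : ℝ) : ℂ) * ∫ x in Set.Ioi (0 : ℝ),
        (1 - Complex.exp ((Complex.I * k - (x : ℂ) ^ 2) * T)) *
          ((x : ℂ) ^ 2 - Complex.I * k)⁻¹ := by
  rw [setIntegral_congr_fun measurableSet_Ioc
    fun t ht => ofReal_φ_mul_exp_eq_integral k ht.1, integral_const_mul,
    integral_integral_swap (integrable_exp_I_mul_sub_sq_mul_prod k T)]
  simp_rw [integral_Ioc_exp_I_mul_sub_sq_mul hk _ hT]

theorem tendsto_integral_one_sub_exp_mul_inv {k : ℝ} (hk : 0 < k) :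
    Tendsto (fun T : ℝ => ∫ x in Set.Ioi (0 : ℝ),
        (1 - Complex.exp ((Complex.I * k - (x : ℂ) ^ 2) * T)) *
          ((x : ℂ) ^ 2 - Complex.I * k)⁻¹) atTop
      (nhds (∫ x in Set.Ioi (0 : ℝ), ((x : ℂ) ^ 2 - Complex.I * k)⁻¹)) := by
  have hc : Continuous (fun x : ℝ => ((x : ℂ) ^ 2 - Complex.I * k)⁻¹) :=
    Continuous.inv₀ (by fun_prop) (sq_sub_I_mul_ne_zero hk.ne')
  refine tendsto_integral_filter_of_dominated_convergence
    (fun x : ℝ => 2 * ‖((x : ℂ) ^ 2 - Complex.I * k)⁻¹‖) ?_ ?_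
    ((integrable_inv_sq_sub_I_mul hk).integrableOn.norm.const_mul 2) ?_
  · exact Eventually.of_forall fun T => Continuous.aestronglyMeasurable (by fun_prop)
  · filter_upwards [eventually_ge_atTop (0 : ℝ)] with T hT
    refine ae_of_all _ fun x => ?_
    rw [norm_mul]
    gcongr
    refine (norm_sub_le _ _).trans ?_
    rw [norm_exp_I_mul_sub_sq_mul, norm_one]
    have : Real.exp (-T * x ^ 2) ≤ 1 := Real.exp_le_one_iff.2 (by nlinarith [sq_nonneg x])
    linarith
  · filter_upwards [ae_restrict_mem measurableSet_Ioi] with x hx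
    have hx : 0 < x := hx
    have hexp : Tendsto (fun T : ℝ => Complex.exp ((Complex.I * k - (x : ℂ) ^ 2) * T)) atTop
        (nhds 0) := by
      rw [tendsto_zero_iff_norm_tendsto_zero]
      simp_rw [norm_exp_I_mul_sub_sq_mul, neg_mul]
      exact Real.tendsto_exp_neg_atTop_nhds_zero.comp
        (tendsto_id.atTop_mul_const (by positivity : 0 < x ^ 2))
    simpa using (hexp.const_sub 1).mul_const (((x : ℂ) ^ 2 - Complex.I * k)⁻¹)

theorem sqrt_two_div_two_mul_self : ((√2 / 2 : ℝ) : ℂ) * ((√2 / 2 : ℝ) : ℂ) = 1 / 2 := by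
  rw [← Complex.ofReal_mul]
  have h : √2 / 2 * (√2 / 2) = (1 / 2 : ℝ) := by
    have := Real.mul_self_sqrt (zero_le_two (α := ℝ))
    linarith
  rw [h]
  norm_num

theorem α_mul_eq_one : α * (((√2 / 2 : ℝ) : ℂ) * (1 + Complex.I)) = 1 := by
  rw [α]
  linear_combination (1 - Complex.I ^ 2) * sqrt_two_div_two_mul_self - 1 / 2 * Complex.I_sq

theorem α_sq : α ^ 2 = -Complex.I := by
  rw [α]
  linear_combination (1 - Complex.I) ^ 2 * sqrt_two_div_two_mul_self + 1 / 2 * Complex.I_sq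

/-- For every `k > 0`, the improper integral `lim_{T→∞} ∫_0^T t^{−1/2} e^{ikt} dt` exists and
equals `√(π/k)·(√2/2)·(1+i)`; equivalently (dividing by `√(2π)`), the Fourier transform of `φ`
at `k` equals `(1/√(2π))·√π/(α√k)`. -/
theorem stmt0 (k : ℝ) (hk : 0 < k) :
    Tendsto (fun T : ℝ => ∫ t in Set.Ioc (0:ℝ) T, (φ t : ℂ) * Complex.exp (Complex.I * k * t))
      atTop (nhds (((Real.sqrt (π / k) * (Real.sqrt 2 / 2) : ℝ) : ℂ) * (1 + Complex.I))) ∧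
    ((Real.sqrt (π / k) * (Real.sqrt 2 / 2) : ℝ) : ℂ) * (1 + Complex.I)
      = (Real.sqrt π : ℂ) / (α * (Real.sqrt k : ℂ)) := by
  have hα : α ≠ 0 := left_ne_zero_of_mul_eq_one α_mul_eq_one
  have hk0 : (√k : ℂ) ≠ 0 := by exact_mod_cast (Real.sqrt_pos.2 hk).ne'
  have hπ0 : (√π : ℂ) ≠ 0 := by exact_mod_cast (Real.sqrt_pos.2 Real.pi_pos).ne'
  have hksq : (√k : ℂ) ^ 2 = k := by exact_mod_cast Real.sq_sqrt hk.le
  have hπsq : (√π : ℂ) ^ 2 = π := by exact_mod_cast Real.sq_sqrt Real.pi_pos.le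
  have hval : ((√(π / k) * (√2 / 2) : ℝ) : ℂ) * (1 + Complex.I) = (√π : ℂ) / (α * (√k : ℂ)) := by
    rw [Real.sqrt_div Real.pi_pos.le, eq_div_iff (mul_ne_zero hα hk0), Complex.ofReal_mul,
      Complex.ofReal_div]
    field_simp
    linear_combination α_mul_eq_one
  refine ⟨?_, hval⟩
  rw [hval]
  have hw : (Complex.I * (α * (√k : ℂ))) ^ 2 = Complex.I * k := by
    rw [mul_pow, mul_pow, α_sq, hksq, Complex.I_sq]
    ring
  have him : 0 < (Complex.I * (α * (√k : ℂ))).im := by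
    have := Real.sqrt_pos.2 hk
    simp [α]
    positivity
  have hlim := (tendsto_integral_one_sub_exp_mul_inv hk).const_mul ((2 / √π : ℝ) : ℂ)
  rw [integral_Ioi_inv_sq_sub_I_mul hk hw him] at hlim
  have hconst : ((2 / √π : ℝ) : ℂ) * (π * Complex.I / (2 * (Complex.I * (α * (√k : ℂ))))) =
      (√π : ℂ) / (α * (√k : ℂ)) := by
    rw [← hπsq]
    push_cast
    field_simp
  rw [hconst] at hlim
  refine hlim.congr' ?_
  filter_upwards [eventually_ge_atTop (0 : ℝ)] with T hT
  exact (integral_Ioc_φ_mul_exp hk.ne' hT).symm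
end

section
/- Let U : ℝ → ℝ be bounded, measurable, and compactly supported. Then ∫_ℝ ∫_ℝ 𝟙_{s>τ} (s−τ)^{−1/2} U(τ) U(s) dτ ds ≥ 0; equivalently, ∫_ℝ (φ*U)(s) U(s) ds ≥ 0, where φ*U denotes convolution. (In other words, the causal kernel φ is of positive type.) -/
open MeasureTheory Filter Real

/-- The causal power `x₊^{-3/4}`, a convolution square root of `|·|^{-1/2}` up to reflection. -/
noncomputable def causalRoot (x : ℝ) : ℝ := if 0 < x then x ^ (-(3 / 4) : ℝ) else 0

lemma measurable_causalRoot : Measurable causalRoot :=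
  Measurable.ite measurableSet_Ioi (by fun_prop) measurable_const

lemma causalRoot_nonneg (x : ℝ) : 0 ≤ causalRoot x := by
  unfold causalRoot
  split_ifs with h <;> positivity

lemma causalRoot_mul {t : ℝ} (ht : 0 < t) (x : ℝ) :
    causalRoot (t * x) = t ^ (-(3 / 4) : ℝ) * causalRoot x := by
  unfold causalRoot
  by_cases hx : 0 < x
  · rw [if_pos hx, if_pos (mul_pos ht hx), mul_rpow ht.le hx.le]
  · rw [if_neg hx, if_neg (by rwa [mul_pos_iff_of_pos_left ht]), mul_zero]

lemma φ_nonneg (x : ℝ) : 0 ≤ φ x := by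
  unfold φ
  split_ifs with h <;> positivity

lemma φ_of_nonpos {x : ℝ} (hx : x ≤ 0) : φ x = 0 := if_neg hx.not_gt

lemma φ_eq_rpow {x : ℝ} (hx : 0 < x) : φ x = x ^ (-(1 / 2) : ℝ) := by
  rw [φ, if_pos hx, sqrt_eq_rpow, rpow_neg hx.le, one_div]

lemma integrable_causalRoot_mul_add_one :
    Integrable fun u => causalRoot u * causalRoot (u + 1) := by
  have hm : Measurable fun u => causalRoot u * causalRoot (u + 1) :=
    measurable_causalRoot.mul (measurable_causalRoot.comp (measurable_id.add_const 1))
  have h1 : IntegrableOn (fun u => causalRoot u * causalRoot (u + 1)) (Set.Ioc 0 1) := by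
    have hi : IntegrableOn (fun u : ℝ => u ^ (-(3 / 4) : ℝ)) (Set.Ioc 0 1) :=
      (intervalIntegrable_iff_integrableOn_Ioc_of_le zero_le_one).1
        (intervalIntegral.intervalIntegrable_rpow' (by norm_num))
    refine Integrable.mono' hi hm.aestronglyMeasurable ?_
    refine (ae_restrict_iff' measurableSet_Ioc).2 (Eventually.of_forall fun u hu => ?_)
    rw [norm_of_nonneg (mul_nonneg (causalRoot_nonneg _) (causalRoot_nonneg _))]
    rw [causalRoot, causalRoot, if_pos hu.1, if_pos (by linarith [hu.1])]
    exact mul_le_of_le_one_right (rpow_nonneg hu.1.le _)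
      (rpow_le_one_of_one_le_of_nonpos (by linarith [hu.1]) (by norm_num))
  have h2 : IntegrableOn (fun u => causalRoot u * causalRoot (u + 1)) (Set.Ioi 1) := by
    have hi : IntegrableOn (fun u : ℝ => u ^ (-(3 / 2) : ℝ)) (Set.Ioi 1) :=
      integrableOn_Ioi_rpow_of_lt (by norm_num) one_pos
    refine Integrable.mono' hi hm.aestronglyMeasurable ?_
    refine (ae_restrict_iff' measurableSet_Ioi).2 (Eventually.of_forall fun u hu => ?_)
    have hu0 : (0 : ℝ) < u := one_pos.trans hu
    rw [norm_of_nonneg (mul_nonneg (causalRoot_nonneg _) (causalRoot_nonneg _))]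
    rw [causalRoot, causalRoot, if_pos hu0, if_pos (by linarith)]
    have hsplit : u ^ (-(3 / 2) : ℝ) = u ^ (-(3 / 4) : ℝ) * u ^ (-(3 / 4) : ℝ) := by
      rw [← rpow_add hu0]; norm_num
    rw [hsplit]
    exact mul_le_mul_of_nonneg_left
      (rpow_le_rpow_of_nonpos hu0 (by linarith) (by norm_num)) (rpow_nonneg hu0.le _)
  have h3 : IntegrableOn (fun u => causalRoot u * causalRoot (u + 1)) (Set.Ioi 0) := by
    rw [← Set.Ioc_union_Ioi_eq_Ioi (zero_le_one' ℝ)]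
    exact h1.union h2
  refine (integrableOn_iff_integrable_of_support_subset fun u hu => ?_).1 h3
  by_contra h
  have h0 : causalRoot u = 0 := if_neg h
  exact hu (by simp [h0])

lemma integral_causalRoot_mul_add_one_pos :
    0 < ∫ u, causalRoot u * causalRoot (u + 1) := by
  rw [integral_pos_iff_support_of_nonneg
    (fun u => mul_nonneg (causalRoot_nonneg _) (causalRoot_nonneg _))
    integrable_causalRoot_mul_add_one]
  have hsub : Set.Ioi (0 : ℝ) ⊆ Function.support fun u => causalRoot u * causalRoot (u + 1) := by
    intro u hu
    have hu : 0 < u := hu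
    have hu1 : 0 < u + 1 := by linarith
    simp only [Function.mem_support, causalRoot, if_pos hu, if_pos hu1]
    positivity
  exact lt_of_lt_of_le (by simp) (measure_mono hsub)

lemma causalRoot_mul_add_eq {t : ℝ} (ht : 0 < t) (r : ℝ) :
    causalRoot r * causalRoot (r + t) =
      t ^ (-(3 / 2) : ℝ) * (causalRoot (r / t) * causalRoot (r / t + 1)) := by
  have h1 : r = t * (r / t) := by field_simp
  have h2 : r + t = t * (r / t + 1) := by field_simp
  have hsplit : t ^ (-(3 / 2) : ℝ) = t ^ (-(3 / 4) : ℝ) * t ^ (-(3 / 4) : ℝ) := by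
    rw [← rpow_add ht]; norm_num
  rw [h2, causalRoot_mul ht, hsplit]
  conv_lhs => rw [h1, causalRoot_mul ht]
  rw [← h1]
  ring

lemma integrable_causalRoot_mul_add {t : ℝ} (ht : 0 < t) :
    Integrable fun r => causalRoot r * causalRoot (r + t) := by
  simp_rw [causalRoot_mul_add_eq ht]
  exact (integrable_causalRoot_mul_add_one.comp_div ht.ne').const_mul _

lemma integral_causalRoot_mul_add {t : ℝ} (ht : 0 < t) :
    ∫ r, causalRoot r * causalRoot (r + t) =
      (∫ u, causalRoot u * causalRoot (u + 1)) * φ t := by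
  simp_rw [causalRoot_mul_add_eq ht]
  rw [integral_const_mul,
    Measure.integral_comp_div (fun u => causalRoot u * causalRoot (u + 1)) t, φ_eq_rpow ht,
    smul_eq_mul, abs_of_pos ht]
  have hsplit : t ^ (-(1 / 2) : ℝ) = t ^ (-(3 / 2) : ℝ) * t := by
    rw [← rpow_add_one ht.ne']; norm_num
  rw [hsplit]
  ring

lemma integrable_causalRoot_sub_mul_sub {s τ : ℝ} (h : s ≠ τ) :
    Integrable fun r => causalRoot (r - s) * causalRoot (r - τ) := by
  rcases h.lt_or_gt with h | h
  · refine ((integrable_causalRoot_mul_add (sub_pos.2 h)).comp_sub_right τ).congr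
      (Eventually.of_forall fun r => ?_)
    simp [mul_comm]
  · refine ((integrable_causalRoot_mul_add (sub_pos.2 h)).comp_sub_right s).congr
      (Eventually.of_forall fun r => ?_)
    simp

lemma integral_causalRoot_sub_mul_sub {s τ : ℝ} (h : s ≠ τ) :
    ∫ r, causalRoot (r - s) * causalRoot (r - τ) =
      (∫ u, causalRoot u * causalRoot (u + 1)) * (φ (s - τ) + φ (τ - s)) := by
  rcases h.lt_or_gt with h | h
  · rw [φ_of_nonpos (sub_nonpos.2 h.le), zero_add, ← integral_causalRoot_mul_add (sub_pos.2 h),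
      ← integral_sub_right_eq_self (fun r => causalRoot r * causalRoot (r + (τ - s))) τ]
    simp [mul_comm]
  · rw [φ_of_nonpos (sub_nonpos.2 h.le), add_zero, ← integral_causalRoot_mul_add (sub_pos.2 h),
      ← integral_sub_right_eq_self (fun r => causalRoot r * causalRoot (r + (s - τ))) s]
    simp

lemma ae_fst_ne_snd : ∀ᵐ p : ℝ × ℝ, p.1 ≠ p.2 := by
  have hm : MeasurableSet {p : ℝ × ℝ | p.1 ≠ p.2} :=
    (measurableSet_eq_fun measurable_fst measurable_snd).compl
  rw [Measure.volume_eq_prod, Measure.ae_prod_iff_ae_ae hm]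
  exact Eventually.of_forall fun s => (ae_iff.2 (by simp))

lemma integrable_φ_sub_mul_mul {U : ℝ → ℝ} (hmeas : Measurable U)
    (hbd : ∃ M : ℝ, ∀ t : ℝ, |U t| ≤ M) (hsupp : HasCompactSupport U) :
    Integrable fun p : ℝ × ℝ => φ (p.1 - p.2) * U p.2 * U p.1 := by
  obtain ⟨M, hM⟩ := hbd
  obtain ⟨R, hR0, hR⟩ := hsupp.isCompact.isBounded.subset_ball_lt 0 0
  have hU0 : ∀ t, U t ≠ 0 → |t| < R := fun t ht => by
    simpa using hR (subset_tsupport U ht)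
  have hU : Integrable U := by
    refine (integrableOn_iff_integrable_of_support_subset (subset_tsupport U)).1 ?_
    exact Measure.integrableOn_of_bounded hsupp.isCompact.measure_lt_top.ne
      hmeas.aestronglyMeasurable (Eventually.of_forall hM)
  have hφ : Integrable ((Set.Ioc 0 (2 * R)).indicator φ) := by
    rw [integrable_indicator_iff measurableSet_Ioc]
    have hi : IntegrableOn (fun u : ℝ => u ^ (-(1 / 2) : ℝ)) (Set.Ioc 0 (2 * R)) :=
      (intervalIntegrable_iff_integrableOn_Ioc_of_le (by positivity)).1
        (intervalIntegral.intervalIntegrable_rpow' (by norm_num))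
    exact hi.congr_fun (fun u hu => (φ_eq_rpow hu.1).symm) measurableSet_Ioc
  have hc := hU.convolution_integrand (ContinuousLinearMap.mul ℝ ℝ) hφ
  have hb := hc.mul_bdd (c := M) (g := fun p : ℝ × ℝ => U p.1)
    (hmeas.comp measurable_fst).aestronglyMeasurable (Eventually.of_forall fun p => hM p.1)
  refine hb.congr (Eventually.of_forall fun p => ?_)
  simp only [ContinuousLinearMap.mul_apply']
  by_cases h1 : U p.1 = 0
  · simp [h1]
  by_cases h2 : U p.2 = 0
  · simp [h2]
  have h1 := abs_lt.1 (hU0 _ h1)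
  have h2 := abs_lt.1 (hU0 _ h2)
  by_cases h : 0 < p.1 - p.2
  · have hmem : p.1 - p.2 ∈ Set.Ioc 0 (2 * R) := ⟨h, by linarith⟩
    rw [Set.indicator_of_mem hmem]
    ring
  · rw [Set.indicator_of_notMem (fun h' => h h'.1), φ_of_nonpos (not_lt.1 h)]
    ring

/-- Let `U : ℝ → ℝ` be bounded, measurable, and compactly supported.  Then
`∫_ℝ (φ*U)(s)·U(s) ds ≥ 0`, where `φ*U` is the convolution
`(φ*U)(s) = ∫_ℝ φ(s−τ) U(τ) dτ = ∫_{τ<s} (s−τ)^{−1/2} U(τ) dτ`: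
the causal kernel `φ` is of positive type. -/
theorem stmt2 (U : ℝ → ℝ) (hmeas : Measurable U) (hbd : ∃ M : ℝ, ∀ t : ℝ, |U t| ≤ M)
    (hsupp : HasCompactSupport U) :
    0 ≤ ∫ s : ℝ, (∫ τ : ℝ, φ (s - τ) * U τ) * U s := by
  have hint := integrable_φ_sub_mul_mul hmeas hbd hsupp
  have hint' : Integrable fun p : ℝ × ℝ => φ (p.2 - p.1) * U p.1 * U p.2 := hint.swap
  have hI : ∫ s : ℝ, (∫ τ : ℝ, φ (s - τ) * U τ) * U s =
      ∫ p : ℝ × ℝ, φ (p.1 - p.2) * U p.2 * U p.1 := by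
    rw [Measure.volume_eq_prod, integral_prod _ hint]
    simp_rw [integral_mul_const]
  have hI' : ∫ p : ℝ × ℝ, φ (p.2 - p.1) * U p.1 * U p.2 =
      ∫ p : ℝ × ℝ, φ (p.1 - p.2) * U p.2 * U p.1 :=
    integral_prod_swap (μ := volume) (ν := volume)
      fun p : ℝ × ℝ => φ (p.1 - p.2) * U p.2 * U p.1
  set C := ∫ u, causalRoot u * causalRoot (u + 1)
  have hCpos : 0 < C := integral_causalRoot_mul_add_one_pos
  set F : ℝ × ℝ → ℝ → ℝ := fun p r =>
    (causalRoot (r - p.1) * U p.1) * (causalRoot (r - p.2) * U p.2) with hF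
  have hFr : ∀ p r, F p r = causalRoot (r - p.1) * causalRoot (r - p.2) * (U p.1 * U p.2) :=
    fun p r => by simp only [hF]; ring
  have hFm : Measurable (Function.uncurry F) := by
    have := measurable_causalRoot
    simp only [hF, Function.uncurry_def]
    fun_prop
  have hFint : ∀ᵐ p : ℝ × ℝ, ∫ r, F p r =
      C * (φ (p.1 - p.2) * U p.2 * U p.1 + φ (p.2 - p.1) * U p.1 * U p.2) := by
    filter_upwards [ae_fst_ne_snd] with p hp
    simp_rw [hFr]
    rw [integral_mul_const, integral_causalRoot_sub_mul_sub hp]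
    ring
  have hFprod : Integrable (Function.uncurry F) ((volume : Measure (ℝ × ℝ)).prod volume) := by
    rw [integrable_prod_iff hFm.aestronglyMeasurable]
    constructor
    · filter_upwards [ae_fst_ne_snd] with p hp
      simp only [Function.uncurry_apply_pair, hFr]
      exact (integrable_causalRoot_sub_mul_sub hp).mul_const _
    · refine ((hint.norm.add hint'.norm).const_mul C).congr ?_
      filter_upwards [ae_fst_ne_snd] with p hp
      simp only [Function.uncurry_apply_pair, hFr, norm_mul, Pi.add_apply,
        norm_of_nonneg (causalRoot_nonneg _), norm_of_nonneg (φ_nonneg _)]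
      rw [integral_mul_const, integral_causalRoot_sub_mul_sub hp]
      ring
  have hkey : C * (2 * ∫ p : ℝ × ℝ, φ (p.1 - p.2) * U p.2 * U p.1) =
      ∫ r, (∫ s, causalRoot (r - s) * U s) ^ 2 := by
    calc _ = ∫ p : ℝ × ℝ, ∫ r, F p r := by
          rw [integral_congr_ae hFint, integral_const_mul, integral_add hint hint', hI', two_mul]
      _ = ∫ r, ∫ p : ℝ × ℝ, F p r := integral_integral_swap hFprod
      _ = _ := by
          refine integral_congr_ae (Eventually.of_forall fun r => ?_)
          simp only [hF, sq]
          exact integral_prod_mul (fun s => causalRoot (r - s) * U s)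
            fun s => causalRoot (r - s) * U s
  have hnn : 0 ≤ ∫ r, (∫ s, causalRoot (r - s) * U s) ^ 2 :=
    integral_nonneg fun r => sq_nonneg _
  rw [← hkey, mul_nonneg_iff_of_pos_left hCpos] at hnn
  rw [hI]
  linarith
end
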